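/- Consider the two-armed stochastic bandit problem. Let Δ > 0, let ν = δ_0 ⊗ N(−Δ,1) (arm 1 yields the constant reward 0, arm 2 has mean −Δ) and ν′ = δ_0 ⊗ N(Δ,1). Then for any policy and any n ≥ 1, max( R_n(ν), R_n(ν′) ) ≥ log(n Δ² / 2) / (4Δ). -/

import Mathlib

open MeasureTheory ProbabilityTheory Real

/-- `IsBanditRun X κ ν Q` states that, under the probability measure `Q`, the process
`X t = (arm pulled at round t, reward observed at round t)` (rounds `t = 0, 1, 2, …`) is a
run of the policy given by the Markov kernels `κ t` (from histories of length `t` to arms)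
on the two-armed bandit instance whose arm `i` has reward distribution `ν i`: conditionally
on the history, the arm `I_t` is drawn according to `κ t` and, conditionally on the history
and `I_t = i`, the reward is drawn according to `ν i`. -/
def IsBanditRun {Ω : Type*} [MeasurableSpace Ω] (X : ℕ → Ω → Fin 2 × ℝ)
    (κ : (t : ℕ) → Kernel (Fin t → Fin 2 × ℝ) (Fin 2))
    (ν : Fin 2 → Measure ℝ) (Q : Measure Ω) : Prop :=
  (∀ t, Measurable (X t)) ∧
    ∀ (t : ℕ) (A : Set (Fin t → Fin 2 × ℝ)), MeasurableSet A →
      ∀ (i : Fin 2) (B : Set ℝ), MeasurableSet B →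
        Q {ω | (fun ℓ : Fin t => X ℓ.val ω) ∈ A ∧ (X t ω).1 = i ∧ (X t ω).2 ∈ B}
          = ∫⁻ h in A, κ t h {i} * ν i B ∂(Q.map fun ω (ℓ : Fin t) => X ℓ.val ω)

/-- The cumulative regret at horizon `n` of the run `X` under the measure `Q`, for a
two-armed instance whose arms have means `m 0` and `m 1`:
`R_n = n·max(m 0, m 1) − ∑_{t<n} E[m (I_t)]`. -/
noncomputable def banditRegret {Ω : Type*} [MeasurableSpace Ω] (X : ℕ → Ω → Fin 2 × ℝ)
    (n : ℕ) (m : Fin 2 → ℝ) (Q : Measure Ω) : ℝ :=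
  n * max (m 0) (m 1) - ∑ t ∈ Finset.range n, ∫ ω, m ((X t ω).1) ∂Q



/-- The history of length `t`. -/
def banditHist {Ω : Type*} (X : ℕ → Ω → Fin 2 × ℝ) (t : ℕ) (ω : Ω) : Fin t → Fin 2 × ℝ :=
  fun ℓ => X ℓ.val ω

lemma measurable_banditHist {Ω : Type*} [MeasurableSpace Ω] {X : ℕ → Ω → Fin 2 × ℝ}
    (hX : ∀ t, Measurable (X t)) (t : ℕ) : Measurable (banditHist X t) :=
  measurable_pi_lambda _ fun ℓ => hX ℓ.val

lemma bandit_map_eq {Ω : Type*} [MeasurableSpace Ω] {X : ℕ → Ω → Fin 2 × ℝ}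
    {κ : (t : ℕ) → Kernel (Fin t → Fin 2 × ℝ) (Fin 2)} [∀ t, IsMarkovKernel (κ t)]
    {ν : Fin 2 → Measure ℝ} [∀ i, IsProbabilityMeasure (ν i)]
    {Q : Measure Ω} [IsProbabilityMeasure Q] (h : IsBanditRun X κ ν Q) (t : ℕ) (i : Fin 2) :
    (Q.restrict {ω | (X t ω).1 = i}).map (fun ω => (banditHist X t ω, (X t ω).2))
      = ((Q.map (banditHist X t)).withDensity (fun g => κ t g {i})).prod (ν i) := by
  obtain ⟨hX, hQ⟩ := h
  have hm := measurable_banditHist hX t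
  have : IsFiniteMeasure ((Q.map (banditHist X t)).withDensity (fun g => κ t g {i})) := by
    have : IsProbabilityMeasure (Q.map (banditHist X t)) :=
      Measure.isProbabilityMeasure_map hm.aemeasurable
    apply isFiniteMeasure_withDensity
    refine ne_of_lt (lt_of_le_of_lt (lintegral_mono (g := fun _ => 1) fun g => prob_le_one) ?_)
    simp
  symm
  apply Measure.prod_eq
  intro A B hA hB
  rw [Measure.map_apply (hm.prodMk (hX t).snd) (hA.prod hB), Measure.restrict_apply
    ((hm.prodMk (hX t).snd) (hA.prod hB)), withDensity_apply _ hA,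
    ← lintegral_mul_const _ ((κ t).measurable_coe (measurableSet_singleton i))]
  refine Eq.trans (congrArg Q ?_) (hQ t A hA i B hB)
  ext ω
  simp only [Set.mem_inter_iff, Set.mem_preimage, Set.mem_prod, Set.mem_ofPred_eq, banditHist]
  tauto

lemma bandit_lintegral {Ω : Type*} [MeasurableSpace Ω] {X : ℕ → Ω → Fin 2 × ℝ}
    {κ : (t : ℕ) → Kernel (Fin t → Fin 2 × ℝ) (Fin 2)} [∀ t, IsMarkovKernel (κ t)]
    {ν : Fin 2 → Measure ℝ} [∀ i, IsProbabilityMeasure (ν i)]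
    {Q : Measure Ω} [IsProbabilityMeasure Q] (h : IsBanditRun X κ ν Q) (t : ℕ) (i : Fin 2)
    (F : (Fin t → Fin 2 × ℝ) × ℝ → ENNReal) (hF : Measurable F) :
    ∫⁻ ω in {ω | (X t ω).1 = i}, F (banditHist X t ω, (X t ω).2) ∂Q
      = ∫⁻ g, κ t g {i} * ∫⁻ x, F (g, x) ∂(ν i) ∂(Q.map (banditHist X t)) := by
  have hm := measurable_banditHist h.1 t
  rw [← lintegral_map (μ := Q.restrict {ω | (X t ω).1 = i}) hF (hm.prodMk (h.1 t).snd),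
    bandit_map_eq h t i, lintegral_prod _ hF.aemeasurable,
    lintegral_withDensity_eq_lintegral_mul _ ((κ t).measurable_coe (measurableSet_singleton i))
      hF.lintegral_prod_right']
  rfl

lemma lintegral_split_arm {Ω : Type*} [MeasurableSpace Ω] {X : Ω → Fin 2 × ℝ}
    (hX : Measurable X) (Q : Measure Ω) (f : Ω → ENNReal) :
    ∫⁻ ω, f ω ∂Q = ∫⁻ ω in {ω | (X ω).1 = 0}, f ω ∂Q + ∫⁻ ω in {ω | (X ω).1 = 1}, f ω ∂Q := by
  have hs : MeasurableSet {ω | (X ω).1 = 0} := hX.fst (measurableSet_singleton 0)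
  rw [← lintegral_add_compl f hs]
  congr 3
  ext ω
  simp only [Set.mem_compl_iff, Set.mem_ofPred_eq]
  omega

/-- One-step likelihood ratio. -/
noncomputable def armRatio (Δ : ℝ) (i : Fin 2) (x : ℝ) : ENNReal :=
  if i = 0 then 1 else ENNReal.ofReal (Real.exp (2 * Δ * x))

lemma measurable_armRatio (Δ : ℝ) (i : Fin 2) : Measurable (armRatio Δ i) := by
  unfold armRatio
  split_ifs <;> fun_prop

lemma gaussian_ratio (Δ : ℝ) :
    gaussianReal Δ 1 = (gaussianReal (-Δ) 1).withDensity
      (fun x => ENNReal.ofReal (Real.exp (2 * Δ * x))) := by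
  rw [gaussianReal_of_var_ne_zero _ one_ne_zero, gaussianReal_of_var_ne_zero _ one_ne_zero,
    ← withDensity_mul _ (measurable_gaussianPDF _ _) (by fun_prop)]
  congr 1
  ext x
  simp only [Pi.mul_apply, gaussianPDF]
  rw [← ENNReal.ofReal_mul (gaussianPDFReal_nonneg _ _ _)]
  congr 1
  simp only [gaussianPDFReal]
  rw [mul_assoc _ (Real.exp _) (Real.exp _), ← Real.exp_add]
  congr 2
  simp only [NNReal.coe_one]
  ring

lemma arm_ratio (Δ : ℝ) (i : Fin 2) (f : ℝ → ENNReal) (hf : Measurable f) :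
    ∫⁻ x, f x ∂(if i = 0 then Measure.dirac 0 else gaussianReal Δ 1)
     = ∫⁻ x, armRatio Δ i x * f x ∂(if i = 0 then Measure.dirac 0 else gaussianReal (-Δ) 1) := by
  unfold armRatio
  split_ifs
  · simp
  · rw [gaussian_ratio, lintegral_withDensity_eq_lintegral_mul _ (by fun_prop) hf]
    rfl

instance arm_prob (m : ℝ) (i : Fin 2) :
    IsProbabilityMeasure (if i = 0 then Measure.dirac 0 else gaussianReal m 1) := by
  split_ifs <;> infer_instance

/-- Change of measure along histories. -/
lemma bandit_change {Ω : Type*} [MeasurableSpace Ω] (Δ : ℝ)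
    {X : ℕ → Ω → Fin 2 × ℝ}
    {κ : (t : ℕ) → Kernel (Fin t → Fin 2 × ℝ) (Fin 2)} [∀ t, IsMarkovKernel (κ t)]
    {P P' : Measure Ω} [IsProbabilityMeasure P] [IsProbabilityMeasure P']
    (hP : IsBanditRun X κ
      (fun i => if i = 0 then Measure.dirac 0 else gaussianReal (-Δ) 1) P)
    (hP' : IsBanditRun X κ
      (fun i => if i = 0 then Measure.dirac 0 else gaussianReal Δ 1) P')
    (t : ℕ) (f : (Fin t → Fin 2 × ℝ) → ENNReal) (hf : Measurable f) :
    ∫⁻ ω, f (banditHist X t ω) ∂P'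
      = ∫⁻ ω, (∏ s ∈ Finset.range t, armRatio Δ (X s ω).1 (X s ω).2) * f (banditHist X t ω) ∂P := by
  induction t with
  | zero =>
    have : ∀ ω, f (banditHist X 0 ω) = f default := fun ω => by
      congr 1; exact Subsingleton.elim _ _
    simp [this]
  | succ t ih =>
    have hsn : ∀ ω, banditHist X (t+1) ω
        = (MeasurableEquiv.piFinSuccAbove (fun _ => Fin 2 × ℝ) (Fin.last t)).symm
          (X t ω, banditHist X t ω) := by
      intro ω
      rw [MeasurableEquiv.eq_symm_apply] 
      refine Prod.ext ?_ ?_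
      · simp [MeasurableEquiv.piFinSuccAbove, banditHist]
      · funext j
        have : Fin.init (banditHist X (t + 1) ω) j = banditHist X t ω j := rfl
        simpa [MeasurableEquiv.piFinSuccAbove] using this
    let e := (MeasurableEquiv.piFinSuccAbove (fun _ : Fin (t+1) => Fin 2 × ℝ) (Fin.last t)).symm
    let F : Fin 2 → (Fin t → Fin 2 × ℝ) × ℝ → ENNReal := fun i p => f (e ((i, p.2), p.1))
    have hF : ∀ i, Measurable (F i) := fun i => hf.comp (e.measurable.comp (by fun_prop))
    have hm := measurable_banditHist hP.1 t
    let G : (s : ℕ) → (Fin s → Fin 2 × ℝ) → ENNReal := fun s g =>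
      ∏ ℓ : Fin s, armRatio Δ (g ℓ).1 (g ℓ).2
    have hAR : Measurable (fun p : Fin 2 × ℝ => armRatio Δ p.1 p.2) :=
      measurable_from_prod_countable_right fun i => measurable_armRatio Δ i
    have hG : ∀ s, Measurable (G s) := fun s =>
      Finset.measurable_fun_prod _ fun ℓ _ => hAR.comp (measurable_pi_apply ℓ)
    have hGX : ∀ s ω, ∏ r ∈ Finset.range s, armRatio Δ (X r ω).1 (X r ω).2
        = G s (banditHist X s ω) := fun s ω => by
      rw [Finset.prod_range]; rfl
    -- the key per-arm identity
    have key : ∀ i, ∫⁻ ω in {ω | (X t ω).1 = i}, f (banditHist X (t+1) ω) ∂P'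
        = ∫⁻ ω in {ω | (X t ω).1 = i},
          (∏ s ∈ Finset.range (t+1), armRatio Δ (X s ω).1 (X s ω).2)
            * f (banditHist X (t+1) ω) ∂P := by
      intro i
      have hsi : MeasurableSet {ω | (X t ω).1 = i} := (hP.1 t).fst (measurableSet_singleton i)
      have hk := (κ t).measurable_coe (measurableSet_singleton i)
      calc _ = ∫⁻ ω in {ω | (X t ω).1 = i}, F i (banditHist X t ω, (X t ω).2) ∂P' := by
            refine setLIntegral_congr_fun hsi fun ω hω => ?_
            simp only [Set.mem_ofPred_eq] at hω
            simp only [F, e, hsn, ← hω]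
        _ = ∫⁻ g, κ t g {i} * ∫⁻ x, F i (g, x)
              ∂(if i = 0 then Measure.dirac 0 else gaussianReal Δ 1)
              ∂(P'.map (banditHist X t)) := bandit_lintegral hP' t i _ (hF i)
        _ = ∫⁻ g, κ t g {i} * ∫⁻ x, armRatio Δ i x * F i (g, x)
              ∂(if i = 0 then Measure.dirac 0 else gaussianReal (-Δ) 1)
              ∂(P'.map (banditHist X t)) := by
            refine lintegral_congr fun g => ?_
            rw [arm_ratio]
            exact (hF i).comp (by fun_prop)
        _ = ∫⁻ g, κ t g {i} * ∫⁻ x, G t g * (armRatio Δ i x * F i (g, x))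
              ∂(if i = 0 then Measure.dirac 0 else gaussianReal (-Δ) 1)
              ∂(P.map (banditHist X t)) := by
            have hAF : Measurable (fun p : (Fin t → Fin 2 × ℝ) × ℝ =>
              armRatio Δ i p.2 * F i p) := ((measurable_armRatio Δ i).comp measurable_snd).mul (hF i)
            have hm1 : Measurable fun g => κ t g {i} * ∫⁻ x, armRatio Δ i x * F i (g, x)
              ∂(if i = 0 then Measure.dirac 0 else gaussianReal (-Δ) 1) :=
              hk.mul hAF.lintegral_prod_right'
            have hGAF : Measurable (fun p : (Fin t → Fin 2 × ℝ) × ℝ =>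
              G t p.1 * (armRatio Δ i p.2 * F i p)) := ((hG t).comp measurable_fst).mul hAF
            have hm2 : Measurable fun g => κ t g {i} *
                ∫⁻ x, G t g * (armRatio Δ i x * F i (g, x))
                  ∂(if i = 0 then Measure.dirac 0 else gaussianReal (-Δ) 1) :=
              hk.mul hGAF.lintegral_prod_right'
            rw [lintegral_map hm1 hm, ih _ hm1,
              lintegral_map hm2 hm]
            refine lintegral_congr fun ω => ?_
            have hsec : Measurable fun x => armRatio Δ i x * F i (banditHist X t ω, x) :=
              hAF.comp (by fun_prop : Measurable fun x : ℝ => (banditHist X t ω, x))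
            rw [hGX, lintegral_const_mul _ hsec]
            ring
        _ = ∫⁻ ω in {ω | (X t ω).1 = i},
              G t (banditHist X t ω) * (armRatio Δ i (X t ω).2 *
                F i (banditHist X t ω, (X t ω).2)) ∂P := by
            symm
            exact bandit_lintegral hP t i
              (fun p => G t p.1 * (armRatio Δ i p.2 * F i p))
              (((hG t).comp measurable_fst).mul
                (((measurable_armRatio Δ i).comp measurable_snd).mul (hF i)))
        _ = _ := by
            refine setLIntegral_congr_fun hsi fun ω hω => ?_
            simp only [Set.mem_ofPred_eq] at hω
            simp only [F, e, hsn, ← hω]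
            rw [Finset.prod_range_succ, hGX, mul_assoc]
    rw [lintegral_split_arm (hP.1 t), lintegral_split_arm (hP.1 t) P, key, key]

/-- Expected reward collected from arm `1`. -/
lemma bandit_reward {Ω : Type*} [MeasurableSpace Ω] (m : ℝ)
    {X : ℕ → Ω → Fin 2 × ℝ}
    {κ : (t : ℕ) → Kernel (Fin t → Fin 2 × ℝ) (Fin 2)} [∀ t, IsMarkovKernel (κ t)]
    {P : Measure Ω} [IsProbabilityMeasure P]
    (hP : IsBanditRun X κ
      (fun i => if i = 0 then Measure.dirac 0 else gaussianReal m 1) P) (t : ℕ) :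
    Integrable (fun ω => (X t ω).2) (P.restrict {ω | (X t ω).1 = 1}) ∧
    ∫ ω in {ω | (X t ω).1 = 1}, (X t ω).2 ∂P = P.real {ω | (X t ω).1 = 1} * m := by
  have hmap := bandit_map_eq hP t 1
  simp only [one_ne_zero, if_false] at hmap
  have hm := measurable_banditHist hP.1 t
  have hmm : Measurable (fun ω => (banditHist X t ω, (X t ω).2)) := hm.prodMk (hP.1 t).snd
  set ρ := (P.map (banditHist X t)).withDensity (fun g => κ t g {1}) with hρ
  have hsnd : (P.restrict {ω | (X t ω).1 = 1}).map (fun ω => (X t ω).2)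
      = P {ω | (X t ω).1 = 1} • gaussianReal m 1 := by
    have h1 : (P.restrict {ω | (X t ω).1 = 1}).map (fun ω => (X t ω).2)
      = ρ Set.univ • gaussianReal m 1 := by
      rw [← Measure.map_snd_prod, ← hmap, Measure.map_map measurable_snd hmm]
      rfl
    have h2 := congrArg (fun μ => μ Set.univ) h1
    simp only [Measure.map_apply (hP.1 t).snd MeasurableSet.univ, Set.preimage_univ,
      Measure.restrict_apply MeasurableSet.univ, Set.univ_inter, Measure.smul_apply, measure_univ,
      smul_eq_mul, mul_one] at h2
    rw [h1, h2]
  have hi : Integrable (fun x : ℝ => x) (gaussianReal m 1) := by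
    exact (memLp_id_gaussianReal (μ := m) (v := 1) 1).integrable (by simp)
  constructor
  · have : Integrable (fun x : ℝ => x)
        ((P.restrict {ω | (X t ω).1 = 1}).map (fun ω => (X t ω).2)) := by
      rw [hsnd]; exact hi.smul_measure (measure_ne_top _ _)
    exact this.comp_measurable (hP.1 t).snd
  · rw [← integral_map (μ := P.restrict {ω | (X t ω).1 = 1}) (f := fun x : ℝ => x)
      (hP.1 t).snd.aemeasurable aestronglyMeasurable_id, hsnd, integral_smul_measure,
      integral_id_gaussianReal]
    rfl

lemma min_pointwise (K s : ℝ) :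
    Real.exp (-K) * (1 + (s + K) / 2) - Real.exp (-K) * (1 + Real.exp s) / 4
      ≤ min 1 (Real.exp s) := by
  -- write everything through `q = exp (s/2)` and `c = exp (-K/2)`
  have hs : Real.exp s = Real.exp (s/2) ^ 2 := by
    rw [← Real.exp_nat_mul]; congr 1; push_cast; ring
  have hK : Real.exp (-K) = Real.exp (-K/2) ^ 2 := by
    rw [← Real.exp_nat_mul]; congr 1; push_cast; ring
  have h1 : Real.exp (-K) * (1 + (s + K) / 2) ≤ Real.exp (-K/2) * Real.exp (s/2) := by
    have : Real.exp (-K/2) * Real.exp (s/2) = Real.exp (-K) * Real.exp ((s+K)/2) := by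
      rw [← Real.exp_add, ← Real.exp_add]; congr 1; ring
    rw [this]
    have := Real.add_one_le_exp ((s+K)/2)
    have := Real.exp_pos (-K)
    nlinarith
  rw [hs] at *
  rw [hK] at h1 ⊢
  set q := Real.exp (s/2)
  set c := Real.exp (-K/2)
  rw [le_min_iff]
  constructor
  · nlinarith [sq_nonneg (c * q / 2 - 1), sq_nonneg c]
  · nlinarith [sq_nonneg (c / 2 - q), sq_nonneg (c*q)]

/-- **Lower bound when only `Δ` is known (Theorem 5).**
Let `Δ > 0`, `ν = δ₀ ⊗ N(−Δ,1)` and `ν' = δ₀ ⊗ N(Δ,1)`.  For any policy (Markov kernels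
`κ`) run on both instances and any `n ≥ 1`,
`max (R_n(ν), R_n(ν')) ≥ log (n Δ² / 2) / (4Δ)`. -/
theorem lower_bound_known_gap_only
    {Ω : Type*} [MeasurableSpace Ω]
    (Δ : ℝ) (hΔ : 0 < Δ)
    (X : ℕ → Ω → Fin 2 × ℝ)
    (κ : (t : ℕ) → Kernel (Fin t → Fin 2 × ℝ) (Fin 2)) [∀ t, IsMarkovKernel (κ t)]
    (P P' : Measure Ω) [IsProbabilityMeasure P] [IsProbabilityMeasure P']
    (hP : IsBanditRun X κ
      (fun i => if i = 0 then Measure.dirac 0 else gaussianReal (-Δ) 1) P)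
    (hP' : IsBanditRun X κ
      (fun i => if i = 0 then Measure.dirac 0 else gaussianReal Δ 1) P')
    (n : ℕ) (hn : 1 ≤ n) :
    Real.log ((n : ℝ) * Δ ^ 2 / 2) / (4 * Δ)
      ≤ max (banditRegret X n (fun i => if i = 0 then 0 else -Δ) P)
          (banditRegret X n (fun i => if i = 0 then 0 else Δ) P') := by
  have hX := hP.1
  have hS : ∀ t i, MeasurableSet {ω | (X t ω).1 = i} := fun t i =>
    (hX t).fst (measurableSet_singleton i)
  set a : ℕ → ℝ := fun t => P.real {ω | (X t ω).1 = 1} with ha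
  set b : ℕ → ℝ := fun t => P'.real {ω | (X t ω).1 = 0} with hb
  -- the two regrets
  have hR : banditRegret X n (fun i => if i = 0 then 0 else -Δ) P
      = Δ * ∑ t ∈ Finset.range n, a t := by
    unfold banditRegret
    have : ∀ t, ∫ ω, (if (X t ω).1 = 0 then 0 else -Δ) ∂P = -Δ * a t := by
      intro t
      have h1 : (fun ω => if (X t ω).1 = 0 then 0 else -Δ)
          = Set.indicator {ω | (X t ω).1 = 1} (fun _ => -Δ) := by
        ext ω
        rcases Fin.exists_fin_two.mp ⟨(X t ω).1, rfl⟩ with h | h <;>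
          simp [Set.indicator, h]
      rw [h1, integral_indicator_const _ (hS t 1)]
      simp [ha, mul_comm]
    simp only [this, ← Finset.mul_sum]
    have : max (0:ℝ) (-Δ) = 0 := max_eq_left (by linarith)
    simp [this]
  have hR' : banditRegret X n (fun i => if i = 0 then 0 else Δ) P'
      = Δ * ∑ t ∈ Finset.range n, b t := by
    unfold banditRegret
    have : ∀ t, ∫ ω, (if (X t ω).1 = 0 then 0 else Δ) ∂P' = Δ - Δ * b t := by
      intro t
      have h1 : (fun ω => if (X t ω).1 = 0 then 0 else Δ)
          = fun ω => Δ - Set.indicator {ω | (X t ω).1 = 0} (fun _ => Δ) ω := by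
        ext ω
        rcases Fin.exists_fin_two.mp ⟨(X t ω).1, rfl⟩ with h | h <;>
          simp [Set.indicator, h]
      rw [h1, integral_sub (integrable_const _) ((integrable_const _).indicator (hS t 0)),
        integral_indicator_const _ (hS t 0)]
      simp [hb, mul_comm]
    simp only [this, Finset.sum_sub_distrib, ← Finset.mul_sum]
    have : max (0:ℝ) Δ = Δ := max_eq_right hΔ.le
    simp [this]
  -- log-likelihood ratio
  set r : ℕ → Ω → ℝ := fun t => Set.indicator {ω | (X t ω).1 = 1} (fun ω => (X t ω).2) with hr
  set S : Ω → ℝ := fun ω => 2 * Δ * ∑ t ∈ Finset.range n, r t ω with hSdef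
  have hri : ∀ t, Integrable (r t) P := fun t =>
    (integrable_indicator_iff (hS t 1)).2 (bandit_reward (-Δ) hP t).1
  have hrint : ∀ t, ∫ ω, r t ω ∂P = - Δ * a t := by
    intro t
    rw [hr, integral_indicator (hS t 1), (bandit_reward (-Δ) hP t).2, mul_comm]
  have hSi : Integrable S P := (integrable_finsetSum _ fun t _ => hri t).const_mul _
  set K : ℝ := 2 * Δ ^ 2 * ∑ t ∈ Finset.range n, a t with hK
  have hSint : ∫ ω, S ω ∂P = -K := by
    rw [hSdef, integral_const_mul, integral_finsetSum _ fun t _ => hri t]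
    simp only [hrint, ← Finset.mul_sum, hK]
    ring
  have hprod : ∀ ω, ∏ s ∈ Finset.range n, armRatio Δ (X s ω).1 (X s ω).2
      = ENNReal.ofReal (Real.exp (S ω)) := by
    intro ω
    rw [hSdef]
    simp only [Finset.mul_sum]
    rw [Real.exp_sum, ENNReal.ofReal_prod_of_nonneg fun _ _ => (Real.exp_pos _).le]
    refine Finset.prod_congr rfl fun s _ => ?_
    rcases Fin.exists_fin_two.mp ⟨(X s ω).1, rfl⟩ with h | h <;>
      simp [armRatio, hr, Set.indicator, h]
  have hrm : ∀ t, Measurable (r t) := fun t => (hX t).snd.indicator (hS t 1)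
  have hSm : Measurable S := (Finset.measurable_fun_sum _ fun t _ => hrm t).const_mul _
  have hZm : Measurable (fun ω => Real.exp (S ω)) := hSm.exp
  have hZ1 : ∫⁻ ω, ENNReal.ofReal (Real.exp (S ω)) ∂P = 1 := by
    have := bandit_change Δ hP hP' n (fun _ => 1) measurable_const
    simp only [hprod, mul_one, lintegral_const, measure_univ] at this
    exact this.symm
  have hZi : Integrable (fun ω => Real.exp (S ω)) P := by
    refine ⟨hZm.aestronglyMeasurable, ?_⟩
    rw [hasFiniteIntegral_iff_ofReal (Filter.Eventually.of_forall fun ω => (Real.exp_pos _).le), hZ1]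
    exact ENNReal.one_lt_top
  have hZint : ∫ ω, Real.exp (S ω) ∂P = 1 := by
    rw [integral_eq_lintegral_of_nonneg_ae
      (Filter.Eventually.of_forall fun ω => (Real.exp_pos _).le) hZm.aestronglyMeasurable, hZ1]
    rfl
  have hbZ : ∀ t ∈ Finset.range n, b t
      = ∫ ω in {ω | (X t ω).1 = 0}, Real.exp (S ω) ∂P := by
    intro t ht
    rw [integral_eq_lintegral_of_nonneg_ae
      (Filter.Eventually.of_forall fun ω => (Real.exp_pos _).le) hZm.aestronglyMeasurable]
    simp only [hb, Measure.real]
    congr 1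
    have hset : MeasurableSet {g : Fin n → Fin 2 × ℝ | (g ⟨t, Finset.mem_range.1 ht⟩).1 = 0} :=
      (measurable_pi_apply (⟨t, Finset.mem_range.1 ht⟩ : Fin n)).fst (measurableSet_singleton 0)
    have := bandit_change Δ hP hP' n
      (Set.indicator {g : Fin n → Fin 2 × ℝ | (g ⟨t, Finset.mem_range.1 ht⟩).1 = 0} 1)
      (measurable_one.indicator hset)
    simp only [hprod] at this
    rw [← lintegral_indicator_one (hS t 0), ← lintegral_indicator (hS t 0)]
    refine Eq.trans this (lintegral_congr fun ω => ?_)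
    simp only [Set.indicator, Set.mem_ofPred_eq, banditHist]
    split_ifs with h <;> simp [h]
  have hstep : ∀ t ∈ Finset.range n, Real.exp (-K) / 2 ≤ a t + b t := by
    intro t ht
    have haI : a t = ∫ ω, Set.indicator {ω | (X t ω).1 = 1} (fun _ => (1:ℝ)) ω ∂P := by
      rw [integral_indicator_const _ (hS t 1)]; simp [ha]
    have hi1 : Integrable (Set.indicator {ω | (X t ω).1 = 1} (fun _ => (1:ℝ))) P :=
      (integrable_const _).indicator (hS t 1)
    have hi2 : Integrable (Set.indicator {ω | (X t ω).1 = 0} (fun ω => Real.exp (S ω))) P :=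
      hZi.indicator (hS t 0)
    rw [hbZ t ht, haI, ← integral_indicator (hS t 0), ← integral_add hi1 hi2]
    have hi0 : Integrable (fun ω => (S ω + K) / 2) P :=
      (hSi.add (integrable_const K)).div_const 2
    have hi3 : Integrable (fun ω => Real.exp (-K) * (1 + (S ω + K) / 2)) P :=
      ((integrable_const (1:ℝ)).add hi0).const_mul _
    have hi4 : Integrable (fun ω => Real.exp (-K) * (1 + Real.exp (S ω)) / 4) P :=
      (((integrable_const (1:ℝ)).add hZi).const_mul _).div_const 4
    have hval : ∫ ω, (Real.exp (-K) * (1 + (S ω + K) / 2)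
        - Real.exp (-K) * (1 + Real.exp (S ω)) / 4) ∂P = Real.exp (-K) / 2 := by
      rw [integral_sub hi3 hi4, integral_const_mul, integral_div, integral_const_mul,
        integral_add (integrable_const _) hZi,
        integral_add (integrable_const _) hi0,
        integral_div, integral_add hSi (integrable_const K), hSint, hZint]
      simp
      ring
    rw [← hval]
    refine integral_mono (hi3.sub hi4) (hi1.add hi2) fun ω => ?_
    refine (min_pointwise K (S ω)).trans ?_
    rcases Fin.exists_fin_two.mp ⟨(X t ω).1, rfl⟩ with h | h <;>
      simp [Set.indicator, h]
  have hsum : n * (Real.exp (-K) / 2) ≤ ∑ t ∈ Finset.range n, a t + ∑ t ∈ Finset.range n, b t := by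
    rw [← Finset.sum_add_distrib]
    have := Finset.card_nsmul_le_sum (Finset.range n) _ _ hstep
    simpa using this
  -- conclusion
  rw [hR, hR']
  set A := ∑ t ∈ Finset.range n, a t
  set B := ∑ t ∈ Finset.range n, b t
  have hn0 : (0:ℝ) < n := by exact_mod_cast hn
  have hA : Δ * A ≤ max (Δ * A) (Δ * B) := le_max_left _ _
  have hB : Δ * B ≤ max (Δ * A) (Δ * B) := le_max_right _ _
  set M := max (Δ * A) (Δ * B)
  have hpos : 0 < (n:ℝ) * Δ ^ 2 / 2 := by positivity
  have hlog : Real.log ((n:ℝ) * Δ^2/2) ≤ K + n * Δ^2/2 * Real.exp (-K) - 1 := by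
    have h := Real.log_le_sub_one_of_pos (mul_pos hpos (Real.exp_pos (-K)))
    rw [Real.log_mul hpos.ne' (Real.exp_pos _).ne', Real.log_exp] at h
    linarith
  rw [div_le_iff₀ (by positivity)]
  have h1 : Δ * (n * (Real.exp (-K) / 2)) ≤ 2 * M := by
    have := mul_le_mul_of_nonneg_left hsum hΔ.le
    linarith
  have h2 : K ≤ 2 * Δ * M := by rw [hK]; nlinarith
  have h3 : n * Δ^2/2 * Real.exp (-K) ≤ 2 * Δ * M := by nlinarith
  linarith
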